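/- Let E be a real inner product space, N ≥ 1, and let L_1, …, L_N : E → ℝ be differentiable functions, each with L_F-Lipschitz gradient (L_F > 0), such that the average L = (1/N)∑_{i=1}^N L_i is bounded below by L* ∈ ℝ. Suppose the bounded-variance condition holds with constant δ_L > 0: (1/N)∑_{i=1}^N ‖∇L_i(ν) − ∇L(ν)‖² ≤ δ_L² for every ν ∈ E. Let 0 < α ≤ 1, let R ≥ 1 and T ≥ 1 be integers, set γ₀ = α/(√(32(R+3))·L_F), C₁ = 4(L(ν₀) − L*), C₂ = 32δ_L²L_F², C₃ = 32(1+R)δ_L²L_F³, and assume C₁ > 0. Then there exists a step size γ with 0 < γ ≤ γ₀/(αR) such that the federated iterates ν₀, ν₁, …, ν_{T} generated with step sizes γ, α and R local steps satisfy (1/T)·∑_{t=0}^{T−1} ‖∇L(ν_t)‖² ≤ C₁/(γ₀·T) + 2·C₁^{3/4}·C₃^{1/4}/(α^{1/2}·T^{3/4}) + 2·C₁^{2/3}·C₂^{1/3}/(α^{2/3}·T^{2/3}). -/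

import Mathlib

/-- `g` is the gradient of `f : E → ℝ` at `x`: the Fréchet derivative of `f` at `x`
is `y ↦ ⟪g, y⟫`. (Stated via `innerSL` so that no completeness of `E` is needed.) -/
def HasGradAt {E : Type*} [NormedAddCommGroup E] [InnerProductSpace ℝ E]
    (f : E → ℝ) (g x : E) : Prop :=
  HasFDerivAt f (innerSL ℝ g) x

/-- The global objective `L = (1/N) ∑ᵢ Lᵢ`. -/
noncomputable def avgFn {E : Type*} (N : ℕ) (Li : Fin N → E → ℝ) : E → ℝ :=
  fun ν => (N : ℝ)⁻¹ * ∑ i, Li i ν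

/-- A function with a `K`-Lipschitz gradient lies below its linearization plus `K ‖y - x‖ ^ 2`. -/
theorem le_linearization_add_of_lipschitz_grad {E : Type*} [NormedAddCommGroup E]
    [InnerProductSpace ℝ E] {f : E → ℝ} {g : E → E} {K : ℝ} (hK : 0 ≤ K)
    (hf : ∀ x, HasGradAt f (g x) x) (hg : ∀ x y, ‖g x - g y‖ ≤ K * ‖x - y‖) (x y : E) :
    f y ≤ f x + inner ℝ (g x) (y - x) + K * ‖y - x‖ ^ 2 := by
  have h := (convex_segment (𝕜 := ℝ) x y).norm_image_sub_le_of_norm_hasFDerivWithin_le'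
    (f := f) (f' := fun z => innerSL ℝ (g z)) (φ := innerSL ℝ (g x)) (C := K * ‖y - x‖)
    (fun z _ => (hf z).hasFDerivWithinAt) (fun z hz => by
      rw [← map_sub, innerSL_apply_norm]
      refine (hg z x).trans (mul_le_mul_of_nonneg_left ?_ hK)
      simpa [norm_sub_rev] using norm_sub_le_of_mem_segment hz)
    (left_mem_segment ℝ x y) (right_mem_segment ℝ x y)
  have h' := (le_abs_self _).trans h
  rw [innerSL_apply_apply] at h'
  nlinarith [h']

/-- The gradient of the average is the average of the gradients. -/
theorem grad_avgFn_eq {E : Type*} [NormedAddCommGroup E] [InnerProductSpace ℝ E]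
    {N : ℕ} {Li : Fin N → E → ℝ} {gi : Fin N → E} {g x : E}
    (hgrad : ∀ i, HasGradAt (Li i) (gi i) x) (hg : HasGradAt (avgFn N Li) g x) :
    g = (N : ℝ)⁻¹ • ∑ i, gi i := by
  have h : HasFDerivAt (avgFn N Li) ((N : ℝ)⁻¹ • ∑ i, innerSL ℝ (gi i)) x :=
    (HasFDerivAt.fun_sum fun i _ => hgrad i).const_mul _
  have h' := HasFDerivAt.unique hg h
  rw [← map_sum, ← map_smul] at h'
  refine ext_inner_right ℝ fun v => ?_
  simpa only [innerSL_apply_apply] using congrArg (fun φ => φ v) h'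

theorem norm_avg_le {E : Type*} [NormedAddCommGroup E] [InnerProductSpace ℝ E]
    {N : ℕ} (v : Fin N → E) :
    ‖(N : ℝ)⁻¹ • ∑ i, v i‖ ≤ (N : ℝ)⁻¹ * ∑ i, ‖v i‖ := by
  rw [norm_smul, Real.norm_of_nonneg (by positivity)]
  exact mul_le_mul_of_nonneg_left (norm_sum_le _ _) (by positivity)

theorem sq_norm_avg_le {E : Type*} [NormedAddCommGroup E] [InnerProductSpace ℝ E]
    {N : ℕ} (v : Fin N → E) :
    ‖(N : ℝ)⁻¹ • ∑ i, v i‖ ^ 2 ≤ (N : ℝ)⁻¹ * ∑ i, ‖v i‖ ^ 2 := by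
  rcases Nat.eq_zero_or_pos N with rfl | hN
  · simp
  have hN' : (0 : ℝ) < N := by exact_mod_cast hN
  have h1 : (∑ i, ‖v i‖) ^ 2 ≤ N * ∑ i, ‖v i‖ ^ 2 := by
    simpa using sq_sum_le_card_mul_sum_sq (s := Finset.univ) (f := fun i => ‖v i‖)
  calc ‖(N : ℝ)⁻¹ • ∑ i, v i‖ ^ 2 ≤ ((N : ℝ)⁻¹ * ∑ i, ‖v i‖) ^ 2 := by
        gcongr
        exact norm_avg_le v
    _ = (N : ℝ)⁻¹ ^ 2 * (∑ i, ‖v i‖) ^ 2 := by ring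
    _ ≤ (N : ℝ)⁻¹ ^ 2 * (N * ∑ i, ‖v i‖ ^ 2) := by gcongr
    _ = (N : ℝ)⁻¹ * ∑ i, ‖v i‖ ^ 2 := by field_simp

/-- `r ≤ R` gradient steps differ from one step of length `r * γ` by a second-order term. -/
theorem norm_grad_steps_sub_le {E : Type*} [NormedAddCommGroup E] [InnerProductSpace ℝ E]
    {g : E → E} {K γ : ℝ} (hK : 0 ≤ K) (hγ : 0 ≤ γ) (hg : ∀ x y, ‖g x - g y‖ ≤ K * ‖x - y‖)
    {R : ℕ} (hR : γ * R * K ≤ 1 / 4) {x : ℕ → E}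
    (hx : ∀ r, x (r + 1) = x r - γ • g (x r)) {r : ℕ} (hr : r ≤ R) :
    ‖((r : ℝ) * γ) • g (x 0) - (x 0 - x r)‖ ≤ r * γ * (2 * (γ * R) * K * ‖g (x 0)‖) := by
  induction r with
  | zero => simp
  | succ r ih =>
    have ih := ih (by omega)
    have hrR : (r : ℝ) ≤ R := by exact_mod_cast (by omega : r ≤ R)
    have hG := norm_nonneg (g (x 0))
    have hd : ‖x 0 - x r‖ ≤ 2 * (γ * R) * ‖g (x 0)‖ := by
      have h1 : ‖x 0 - x r‖ ≤ ‖((r : ℝ) * γ) • g (x 0) - (x 0 - x r)‖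
          + ‖((r : ℝ) * γ) • g (x 0)‖ := by
        rw [add_comm]
        simpa using norm_sub_le (((r : ℝ) * γ) • g (x 0))
          (((r : ℝ) * γ) • g (x 0) - (x 0 - x r))
      rw [norm_smul, Real.norm_of_nonneg (by positivity)] at h1
      have h2 : 2 * (γ * R) * K * ‖g (x 0)‖ ≤ ‖g (x 0)‖ := by nlinarith
      have h3 : r * γ * (2 * (γ * R) * K * ‖g (x 0)‖) ≤ r * γ * ‖g (x 0)‖ := by gcongr
      have h4 : r * γ * ‖g (x 0)‖ ≤ R * γ * ‖g (x 0)‖ := by gcongr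
      linarith
    have he : (((r + 1 : ℕ) : ℝ) * γ) • g (x 0) - (x 0 - x (r + 1))
        = (((r : ℝ) * γ) • g (x 0) - (x 0 - x r)) + γ • (g (x 0) - g (x r)) := by
      rw [hx r]
      push_cast
      module
    have hs : ‖γ • (g (x 0) - g (x r))‖ ≤ γ * (K * (2 * (γ * R) * ‖g (x 0)‖)) := by
      rw [norm_smul, Real.norm_of_nonneg hγ]
      gcongr
      exact (hg _ _).trans (by gcongr)
    rw [he]
    refine (norm_add_le _ _).trans ((add_le_add ih hs).trans (le_of_eq ?_))
    push_cast
    ring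

/-- One communication round decreases a smooth objective, up to a client-drift error, when the
averaged displacement `v` is close to `s` times the gradient. -/
theorem descent_of_approx_grad {E : Type*} [NormedAddCommGroup E] [InnerProductSpace ℝ E]
    {f : E → ℝ} {g : E → E} {K s α δ : ℝ} (hK : 0 ≤ K) (hs : 0 < s) (hsK : s * K ≤ 1 / 4)
    (hα0 : 0 ≤ α) (hα1 : α ≤ 1)
    (hf : ∀ x, HasGradAt f (g x) x) (hg : ∀ x y, ‖g x - g y‖ ≤ K * ‖x - y‖) {x v : E}
    (hv : ‖s • g x - v‖ ^ 2 ≤ 8 * s ^ 4 * K ^ 2 * (‖g x‖ ^ 2 + δ ^ 2)) :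
    α * s / 4 * ‖g x‖ ^ 2 ≤ f x - f (x - α • v) + 4 * α * s ^ 3 * K ^ 2 * δ ^ 2 := by
  have h := le_linearization_add_of_lipschitz_grad hK hf hg x (x - α • v)
  have he : x - α • v - x = -(α • v) := by abel
  rw [he, norm_neg, inner_neg_right, inner_smul_right, norm_smul, Real.norm_of_nonneg hα0] at h
  rw [norm_sub_sq_real, inner_smul_left, norm_smul, Real.norm_of_nonneg hs.le] at hv
  simp only [conj_trivial] at hv
  have h1 : s ^ 2 * K ^ 2 ≤ 1 / 16 := by
    have : 0 ≤ s * K := by positivity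
    nlinarith
  have h2 : 2 * (α * s * K) ≤ 1 := by
    have : 0 ≤ s * K := by positivity
    nlinarith
  set p := inner ℝ (g x) v
  set G := ‖g x‖
  have h3 : s ^ 2 * K ^ 2 * (s * G ^ 2) ≤ 1 / 16 * (s * G ^ 2) := by gcongr
  have h4 : 2 * (α * s * K) * ‖v‖ ^ 2 ≤ 1 * ‖v‖ ^ 2 := by gcongr
  have h5 : s ^ 2 * G ^ 2 / 2 + ‖v‖ ^ 2 ≤ 2 * (s * p) + 8 * s ^ 4 * K ^ 2 * δ ^ 2 := by
    nlinarith
  have h6 : s * G ^ 2 / 4 ≤ p - α * K * ‖v‖ ^ 2 + 4 * s ^ 3 * K ^ 2 * δ ^ 2 := by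
    refine le_of_mul_le_mul_left ?_ hs
    nlinarith
  nlinarith [mul_le_mul_of_nonneg_left h6 hα0]

/-- The averaged displacement of a communication round is close to a long gradient step. -/
theorem sq_norm_round_sub_le {E : Type*} [NormedAddCommGroup E] [InnerProductSpace ℝ E]
    {N : ℕ} (hN : 1 ≤ N) {gi : Fin N → E → E} {K γ δ : ℝ} (hK : 0 ≤ K) (hγ : 0 ≤ γ)
    (hLip : ∀ i x y, ‖gi i x - gi i y‖ ≤ K * ‖x - y‖) {R : ℕ} (hR : γ * R * K ≤ 1 / 4)
    {x G : E} (hG : G = (N : ℝ)⁻¹ • ∑ i, gi i x)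
    (hvar : (N : ℝ)⁻¹ * ∑ i, ‖gi i x - G‖ ^ 2 ≤ δ ^ 2) {y : Fin N → ℕ → E}
    (hy0 : ∀ i, y i 0 = x) (hy : ∀ i r, y i (r + 1) = y i r - γ • gi i (y i r)) :
    ‖(γ * R) • G - (x - (N : ℝ)⁻¹ • ∑ i, y i R)‖ ^ 2 ≤
      8 * (γ * R) ^ 4 * K ^ 2 * (‖G‖ ^ 2 + δ ^ 2) := by
  have hN' : (N : ℝ) ≠ 0 := by exact_mod_cast (by omega : N ≠ 0)
  have he : (γ * R) • G - (x - (N : ℝ)⁻¹ • ∑ i, y i R)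
      = (N : ℝ)⁻¹ • ∑ i, (((R : ℝ) * γ) • gi i x - (x - y i R)) := by
    rw [Finset.sum_sub_distrib, Finset.sum_sub_distrib, ← Finset.smul_sum, hG]
    simp only [Finset.sum_const, Finset.card_univ, Fintype.card_fin, ← Nat.cast_smul_eq_nsmul ℝ,
      smul_sub, smul_smul, inv_mul_cancel₀ hN', one_smul]
    congr 2
    ring
  rw [he]
  refine (sq_norm_avg_le _).trans ?_
  have hi : ∀ i, ‖((R : ℝ) * γ) • gi i x - (x - y i R)‖ ^ 2 ≤
      8 * (γ * R) ^ 4 * K ^ 2 * (‖G‖ ^ 2 + ‖gi i x - G‖ ^ 2) := by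
    intro i
    have h1 := norm_grad_steps_sub_le hK hγ (hLip i) hR (hy i) le_rfl
    rw [hy0 i] at h1
    have h2 : ‖gi i x‖ ^ 2 ≤ 2 * (‖G‖ ^ 2 + ‖gi i x - G‖ ^ 2) := by
      have h3 : ‖gi i x‖ ≤ ‖G‖ + ‖gi i x - G‖ := by
        simpa using norm_add_le G (gi i x - G)
      nlinarith [norm_nonneg (gi i x), sq_nonneg (‖G‖ - ‖gi i x - G‖)]
    calc _ ≤ (R * γ * (2 * (γ * R) * K * ‖gi i x‖)) ^ 2 := by gcongr
      _ = 4 * (γ * R) ^ 4 * K ^ 2 * ‖gi i x‖ ^ 2 := by ring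
      _ ≤ 4 * (γ * R) ^ 4 * K ^ 2 * (2 * (‖G‖ ^ 2 + ‖gi i x - G‖ ^ 2)) := by gcongr
      _ = _ := by ring
  calc _ ≤ (N : ℝ)⁻¹ * ∑ i, 8 * (γ * R) ^ 4 * K ^ 2 * (‖G‖ ^ 2 + ‖gi i x - G‖ ^ 2) := by
        gcongr with i
        exact hi i
    _ = 8 * (γ * R) ^ 4 * K ^ 2 * (‖G‖ ^ 2 + (N : ℝ)⁻¹ * ∑ i, ‖gi i x - G‖ ^ 2) := by
        rw [← Finset.mul_sum, Finset.sum_add_distrib]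
        simp only [Finset.sum_const, Finset.card_univ, Fintype.card_fin, nsmul_eq_mul]
        field_simp
    _ ≤ _ := by gcongr

/-- The step size `min η₀ η₁`, where `η₁` balances the two terms of the bound. -/
theorem exists_balanced_step {η₀ A B α T : ℝ} (hη₀ : 0 < η₀) (hA : 0 < A) (hB : 0 < B)
    (hα : 0 < α) (hT : 0 < T) :
    ∃ η, 0 < η ∧ η ≤ η₀ ∧ A / (η * T) + B * η ^ 2 / α ^ 2 ≤ A / (η₀ * T) +
      2 * A ^ ((2 : ℝ) / 3) * B ^ ((1 : ℝ) / 3) / (α ^ ((2 : ℝ) / 3) * T ^ ((2 : ℝ) / 3)) := by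
  obtain ⟨a, ha, rfl⟩ : ∃ a : ℝ, 0 < a ∧ a ^ 3 = A :=
    ⟨A ^ ((1 : ℝ) / 3), by positivity, by rw [← Real.rpow_mul_natCast hA.le]; norm_num⟩
  obtain ⟨b, hb, rfl⟩ : ∃ a : ℝ, 0 < a ∧ a ^ 3 = B :=
    ⟨B ^ ((1 : ℝ) / 3), by positivity, by rw [← Real.rpow_mul_natCast hB.le]; norm_num⟩
  obtain ⟨c, hc, rfl⟩ : ∃ a : ℝ, 0 < a ∧ a ^ 3 = α :=
    ⟨α ^ ((1 : ℝ) / 3), by positivity, by rw [← Real.rpow_mul_natCast hα.le]; norm_num⟩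
  obtain ⟨d, hd, rfl⟩ : ∃ a : ℝ, 0 < a ∧ a ^ 3 = T :=
    ⟨T ^ ((1 : ℝ) / 3), by positivity, by rw [← Real.rpow_mul_natCast hT.le]; norm_num⟩
  have h23 : ∀ x : ℝ, 0 < x → (x ^ 3) ^ ((2 : ℝ) / 3) = x ^ 2 := fun x hx => by
    rw [← Real.rpow_natCast_mul hx.le]; norm_num
  have h13 : ∀ x : ℝ, 0 < x → (x ^ 3) ^ ((1 : ℝ) / 3) = x := fun x hx => by
    rw [← Real.rpow_natCast_mul hx.le]; norm_num
  rw [h23 a ha, h13 b hb, h23 c hc, h23 d hd]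
  set η₁ := a * c ^ 2 / (b * d) with hη₁
  have hη₁pos : 0 < η₁ := by positivity
  have hbal₁ : a ^ 3 / (η₁ * d ^ 3) = a ^ 2 * b / (c ^ 2 * d ^ 2) := by
    rw [hη₁]; field_simp
  have hbal₂ : b ^ 3 * η₁ ^ 2 / (c ^ 3) ^ 2 = a ^ 2 * b / (c ^ 2 * d ^ 2) := by
    rw [hη₁]; field_simp
  have htwo : 2 * a ^ 2 * b / (c ^ 2 * d ^ 2)
      = a ^ 2 * b / (c ^ 2 * d ^ 2) + a ^ 2 * b / (c ^ 2 * d ^ 2) := by ring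
  have hpos₁ : 0 ≤ a ^ 2 * b / (c ^ 2 * d ^ 2) := by positivity
  have hpos₂ : 0 ≤ a ^ 3 / (η₀ * d ^ 3) := by positivity
  rw [htwo]
  rcases le_total η₀ η₁ with h | h
  · refine ⟨η₀, hη₀, le_rfl, ?_⟩
    have : b ^ 3 * η₀ ^ 2 / (c ^ 3) ^ 2 ≤ b ^ 3 * η₁ ^ 2 / (c ^ 3) ^ 2 := by gcongr
    linarith
  · refine ⟨η₁, hη₁pos, h, ?_⟩
    linarith

/-- Corollary 1 of the paper, deterministic, explicit constants:
under `L_F`-smoothness of the local objectives, bounded variance `δ_L`, a lower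
bound `L*` on the global objective, `0 < α ≤ 1`, `R, T ≥ 1`, with
`γ₀ = α/(√(32(R+3))·L_F)`, `C₁ = 4(L(ν₀) − L*) > 0`, `C₂ = 32δ_L²L_F²`,
`C₃ = 32(1+R)δ_L²L_F³`, there is a step size `0 < γ ≤ γ₀/(αR)` such that the
federated iterates achieve the `O(1/T^{2/3})` rate with the stated constants. -/
theorem stmt12 {E : Type*} [NormedAddCommGroup E] [InnerProductSpace ℝ E]
    (N : ℕ) (hN : 1 ≤ N) (Li : Fin N → E → ℝ) (gi : Fin N → E → E)
    (hgrad : ∀ i x, HasGradAt (Li i) (gi i x) x)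
    (LF : ℝ) (hLF : 0 < LF)
    (hLip : ∀ i x y, ‖gi i x - gi i y‖ ≤ LF * ‖x - y‖)
    (gL : E → E) (hgL : ∀ x, HasGradAt (avgFn N Li) (gL x) x)
    (Lstar : ℝ) (hbelow : ∀ ν : E, Lstar ≤ avgFn N Li ν)
    (δL : ℝ) (hδL : 0 < δL)
    (hvar : ∀ ν : E, (N : ℝ)⁻¹ * ∑ i, ‖gi i ν - gL ν‖ ^ 2 ≤ δL ^ 2)
    (α : ℝ) (hα0 : 0 < α) (hα1 : α ≤ 1)
    (R T : ℕ) (hR : 1 ≤ R) (hT : 1 ≤ T)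
    (ν₀ : E) (γ₀ C₁ C₂ C₃ : ℝ)
    (hγ₀ : γ₀ = α / (Real.sqrt (32 * ((R : ℝ) + 3)) * LF))
    (hC₁ : C₁ = 4 * (avgFn N Li ν₀ - Lstar))
    (hC₂ : C₂ = 32 * δL ^ 2 * LF ^ 2)
    (hC₃ : C₃ = 32 * (1 + (R : ℝ)) * δL ^ 2 * LF ^ 3)
    (hC₁pos : 0 < C₁) :
    ∃ γ : ℝ, 0 < γ ∧ γ ≤ γ₀ / (α * (R : ℝ)) ∧
      ∀ (ν : ℕ → E) (νloc : ℕ → Fin N → ℕ → E),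
        ν 0 = ν₀ →
        (∀ t i, νloc t i 0 = ν t) →
        (∀ t i r, νloc t i (r + 1) = νloc t i r - γ • gi i (νloc t i r)) →
        (∀ t, ν (t + 1) = ν t - α • (ν t - (N : ℝ)⁻¹ • ∑ i, νloc t i R)) →
        (1 / (T : ℝ)) * ∑ t ∈ Finset.range T, ‖gL (ν t)‖ ^ 2 ≤
          C₁ / (γ₀ * (T : ℝ))
            + 2 * C₁ ^ ((3 : ℝ) / 4) * C₃ ^ ((1 : ℝ) / 4) /
                (α ^ ((1 : ℝ) / 2) * (T : ℝ) ^ ((3 : ℝ) / 4))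
            + 2 * C₁ ^ ((2 : ℝ) / 3) * C₂ ^ ((1 : ℝ) / 3) /
                (α ^ ((2 : ℝ) / 3) * (T : ℝ) ^ ((2 : ℝ) / 3)) := by
  have hR' : (0 : ℝ) < R := by exact_mod_cast hR
  have hT' : (0 : ℝ) < T := by exact_mod_cast hT
  have hγ₀pos : 0 < γ₀ := by rw [hγ₀]; positivity
  have hC₂pos : 0 < C₂ := by rw [hC₂]; positivity
  have hC₃pos : 0 < C₃ := by rw [hC₃]; positivity
  have hγ₀LF : γ₀ * LF ≤ α / 4 := by
    have hsqrt : 4 ≤ Real.sqrt (32 * ((R : ℝ) + 3)) :=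
      Real.le_sqrt_of_sq_le (by nlinarith)
    have he : γ₀ * LF = α / Real.sqrt (32 * ((R : ℝ) + 3)) := by
      rw [hγ₀]; field_simp
    rw [he]
    gcongr
  have hgLeq : ∀ x, gL x = (N : ℝ)⁻¹ • ∑ i, gi i x := fun x =>
    grad_avgFn_eq (fun i => hgrad i x) (hgL x)
  have hgLLip : ∀ x y, ‖gL x - gL y‖ ≤ LF * ‖x - y‖ := by
    intro x y
    rw [hgLeq, hgLeq, ← smul_sub, ← Finset.sum_sub_distrib]
    refine (norm_avg_le _).trans ?_
    calc _ ≤ (N : ℝ)⁻¹ * ∑ _i : Fin N, LF * ‖x - y‖ := by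
          gcongr with i
          exact hLip i x y
      _ = _ := by
          have hN' : (N : ℝ) ≠ 0 := by exact_mod_cast (by omega : N ≠ 0)
          simp [hN']
  obtain ⟨η, hη, hηle, hbound⟩ := exists_balanced_step hγ₀pos hC₁pos hC₂pos hα0 hT'
  refine ⟨η / (α * R), by positivity, by gcongr, ?_⟩
  intro ν νloc hν0 hloc0 hloc hν
  set s := η / (α * R) * R with hs
  have hsη : s = η / α := by rw [hs]; field_simp
  have hspos : 0 < s := by rw [hs]; positivity
  have hαs : α * s = η := by rw [hsη]; field_simp
  have hsLF : s * LF ≤ 1 / 4 := by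
    refine le_of_mul_le_mul_left ?_ hα0
    nlinarith
  have hstep : ∀ t, η / 4 * ‖gL (ν t)‖ ^ 2 ≤
      avgFn N Li (ν t) - avgFn N Li (ν (t + 1)) + 4 * η * s ^ 2 * LF ^ 2 * δL ^ 2 := by
    intro t
    have h := descent_of_approx_grad hLF.le hspos hsLF hα0.le hα1 hgL hgLLip
      (sq_norm_round_sub_le hN hLF.le (by positivity) hLip hsLF (hgLeq (ν t)) (hvar (ν t))
        (hloc0 t) (hloc t))
    rw [← hν t] at h
    rw [← hαs]
    linarith
  have hsum : η / 4 * ∑ t ∈ Finset.range T, ‖gL (ν t)‖ ^ 2 ≤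
      C₁ / 4 + T * (4 * η * s ^ 2 * LF ^ 2 * δL ^ 2) := by
    rw [Finset.mul_sum]
    refine (Finset.sum_le_sum fun t _ => hstep t).trans ?_
    rw [Finset.sum_add_distrib, Finset.sum_range_sub', Finset.sum_const, Finset.card_range,
      nsmul_eq_mul, hν0, hC₁]
    linarith [hbelow (ν T)]
  have havg : (1 / (T : ℝ)) * ∑ t ∈ Finset.range T, ‖gL (ν t)‖ ^ 2 ≤
      C₁ / (η * T) + C₂ * η ^ 2 / α ^ 2 := by
    have h16 : 16 * s ^ 2 * LF ^ 2 * δL ^ 2 ≤ C₂ * η ^ 2 / α ^ 2 := by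
      have he : C₂ * η ^ 2 / α ^ 2 = 32 * s ^ 2 * LF ^ 2 * δL ^ 2 := by
        rw [hsη, hC₂]; field_simp
      have : 0 ≤ s ^ 2 * LF ^ 2 * δL ^ 2 := by positivity
      linarith
    calc (1 / (T : ℝ)) * ∑ t ∈ Finset.range T, ‖gL (ν t)‖ ^ 2
        = 4 / (η * T) * (η / 4 * ∑ t ∈ Finset.range T, ‖gL (ν t)‖ ^ 2) := by field_simp
      _ ≤ 4 / (η * T) * (C₁ / 4 + T * (4 * η * s ^ 2 * LF ^ 2 * δL ^ 2)) := by gcongr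
      _ = C₁ / (η * T) + 16 * s ^ 2 * LF ^ 2 * δL ^ 2 := by field_simp; ring
      _ ≤ _ := by gcongr
  have hmid : 0 ≤ 2 * C₁ ^ ((3 : ℝ) / 4) * C₃ ^ ((1 : ℝ) / 4) /
      (α ^ ((1 : ℝ) / 2) * (T : ℝ) ^ ((3 : ℝ) / 4)) := by positivity
  linarith
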